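/- Assume the decomposition hypotheses for the frame (ξ1, ξ2) along x, including the frame condition that ∂ξ_k/∂u_i has no ξ2-component. Given p ∈ ℝ⁴, let Z: U → ℝ², δ: U → ℝ, s: U → ℝ be the unique smooth maps with x(u) − p = dx(u)(Z(u)) + δ(u) ξ1(u) + s(u) ξ2(u). Let u0 ∈ U with Z(u0) = 0 (i.e. x(u0) − p ∈ span{ξ1(u0), ξ2(u0)}). Then u0 is a critical point of s, and the Hessian matrix of s at u0 satisfies, for all i, j ∈ {1,2}: ∂²s/∂u_i∂u_j(u0) = −h2(u0)(e_i, (Id + δ(u0) S1(u0) + s(u0) S2(u0)) e_j). Equivalently, writing p = x(u0) + λν with λν = −δ(u0)ξ1(u0) − s(u0)ξ2(u0) and λS_ν := −δ(u0)S1(u0) − s(u0)S2(u0), the Hessian is H(X,Y) = h2(X, (−Id + λS_ν)Y). -/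

import Mathlib

open Matrix

/-- The partial derivative of `f` in the `i`-th coordinate direction at `u`. -/
noncomputable def pder {E : Type*} [NormedAddCommGroup E] [NormedSpace ℝ E]
    (f : (Fin 2 → ℝ) → E) (i : Fin 2) (u : Fin 2 → ℝ) : E :=
  fderiv ℝ f u (Pi.single i 1)

section PartialDerivatives

variable {E : Type*} [NormedAddCommGroup E] [NormedSpace ℝ E]

theorem fderiv_apply_eq_pder (f : (Fin 2 → ℝ) → E) (u v : Fin 2 → ℝ) :
    fderiv ℝ f u v = v 0 • pder f 0 u + v 1 • pder f 1 u := by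
  have hv : v = v 0 • Pi.single 0 1 + v 1 • Pi.single 1 1 := by
    ext k; fin_cases k <;> simp
  conv_lhs => rw [hv]
  rw [map_add, map_smul, map_smul, pder, pder]

theorem pder_congr {f g : (Fin 2 → ℝ) → E} {U : Set (Fin 2 → ℝ)} (hU : IsOpen U)
    (hfg : ∀ u ∈ U, f u = g u) {u : Fin 2 → ℝ} (hu : u ∈ U) (i : Fin 2) :
    pder f i u = pder g i u := by
  rw [pder, pder, Filter.EventuallyEq.fderiv_eq (Filter.eventuallyEq_of_mem (hU.mem_nhds hu) hfg)]

theorem pder_fun_add {f g : (Fin 2 → ℝ) → E} {u : Fin 2 → ℝ} (hf : DifferentiableAt ℝ f u)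
    (hg : DifferentiableAt ℝ g u) (i : Fin 2) :
    pder (fun w => f w + g w) i u = pder f i u + pder g i u := by
  simp [pder, fderiv_fun_add hf hg]

theorem pder_fun_neg (f : (Fin 2 → ℝ) → E) (i : Fin 2) (u : Fin 2 → ℝ) :
    pder (fun w => -f w) i u = -pder f i u := by
  simp [pder, fderiv_fun_neg]

theorem pder_fun_sub_const (f : (Fin 2 → ℝ) → E) (p : E) (i : Fin 2) (u : Fin 2 → ℝ) :
    pder (fun w => f w - p) i u = pder f i u := by
  simp [pder, fderiv_sub_const]

theorem pder_fun_smul {c : (Fin 2 → ℝ) → ℝ} {f : (Fin 2 → ℝ) → E} {u : Fin 2 → ℝ}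
    (hc : DifferentiableAt ℝ c u) (hf : DifferentiableAt ℝ f u) (i : Fin 2) :
    pder (fun w => c w • f w) i u = c u • pder f i u + pder c i u • f u := by
  simp [pder, fderiv_fun_smul hc hf]

theorem ContDiffOn.contDiffOn_pder {f : (Fin 2 → ℝ) → E} {U : Set (Fin 2 → ℝ)} (hU : IsOpen U)
    (hf : ContDiffOn ℝ (⊤ : ℕ∞) f U) (i : Fin 2) : ContDiffOn ℝ (⊤ : ℕ∞) (pder f i) U :=
  (hf.fderiv_of_isOpen hU (m := (⊤ : ℕ∞)) le_rfl).clm_apply contDiffOn_const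

theorem pder_comm {f : (Fin 2 → ℝ) → E} {U : Set (Fin 2 → ℝ)} (hU : IsOpen U)
    (hf : ContDiffOn ℝ (⊤ : ℕ∞) f U) {u : Fin 2 → ℝ} (hu : u ∈ U) (i j : Fin 2) :
    pder (pder f j) i u = pder (pder f i) j u := by
  have hd : DifferentiableAt ℝ (fderiv ℝ f) u :=
    ((hf.fderiv_of_isOpen hU (m := (⊤ : ℕ∞)) le_rfl).contDiffAt
      (hU.mem_nhds hu)).differentiableAt (by simp)
  have key (k l : Fin 2) :
      pder (pder f l) k u = fderiv ℝ (fderiv ℝ f) u (Pi.single k 1) (Pi.single l 1) := by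
    have h := (hd.hasFDerivAt.clm_apply
      (hasFDerivAt_const (Pi.single l (1 : ℝ) : Fin 2 → ℝ) u)).fderiv
    change fderiv ℝ (fun w => fderiv ℝ f w (Pi.single l 1)) u _ = _
    rw [h]
    simp
  rw [key, key]
  exact ((hf.contDiffAt (hU.mem_nhds hu)).isSymmSndFDerivAt
    (by simpa using WithTop.coe_le_coe.2 (le_top : (2 : ℕ∞) ≤ ⊤))).eq _ _

theorem eq_zero_of_fderiv_apply_add_smul_eq_zero {x : (Fin 2 → ℝ) → E} {u : Fin 2 → ℝ} {a b : E}
    (hind : LinearIndependent ℝ ![pder x 0 u, pder x 1 u, a, b]) {v : Fin 2 → ℝ} {α β : ℝ}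
    (h : fderiv ℝ x u v + α • a + β • b = 0) : v = 0 ∧ β = 0 := by
  have h' := Fintype.linearIndependent_iff.1 hind ![v 0, v 1, α, β] (by
    rw [fderiv_apply_eq_pder] at h
    simpa [Fin.sum_univ_four] using h)
  refine ⟨?_, h' 3⟩
  ext k
  fin_cases k
  exacts [h' 0, h' 1]

end PartialDerivatives

/-- Under the decomposition hypotheses for the transversal frame `(ξ1, ξ2)` along `x`
(including the condition that `∂ξ_k/∂u_i` has no `ξ2`-component), if `Z(u0) = 0`
(i.e. `x(u0) − p ∈ span{ξ1(u0), ξ2(u0)}`), then `u0` is a critical point of the affine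
distance function `s` and its Hessian at `u0` satisfies
`∂²s/∂u_i∂u_j(u0) = −h2(u0)(e_i, (Id + δ(u0) S1(u0) + s(u0) S2(u0)) e_j)`. -/
theorem stmt8 (U : Set (Fin 2 → ℝ)) (hU : IsOpen U)
    (x ξ1 ξ2 : (Fin 2 → ℝ) → (Fin 4 → ℝ))
    (hx : ContDiffOn ℝ (⊤ : ℕ∞) x U) (hξ1 : ContDiffOn ℝ (⊤ : ℕ∞) ξ1 U)
    (hξ2 : ContDiffOn ℝ (⊤ : ℕ∞) ξ2 U)
    (hind : ∀ u ∈ U, LinearIndependent ℝ ![pder x 0 u, pder x 1 u, ξ1 u, ξ2 u])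
    (Γ : (Fin 2 → ℝ) → Fin 2 → Fin 2 → (Fin 2 → ℝ))
    (h1 h2 : (Fin 2 → ℝ) → Fin 2 → Fin 2 → ℝ)
    (hΓ : ContDiffOn ℝ (⊤ : ℕ∞) Γ U)
    (hh1 : ContDiffOn ℝ (⊤ : ℕ∞) h1 U) (hh2 : ContDiffOn ℝ (⊤ : ℕ∞) h2 U)
    (hdec2 : ∀ u ∈ U, ∀ i j : Fin 2,
      pder (pder x j) i u =
        fderiv ℝ x u (Γ u i j) + h1 u i j • ξ1 u + h2 u i j • ξ2 u)
    (S1 S2 : (Fin 2 → ℝ) → Fin 2 → Fin 2 → ℝ)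
    (τ1 τ2 : (Fin 2 → ℝ) → (Fin 2 → ℝ))
    (hS1 : ContDiffOn ℝ (⊤ : ℕ∞) S1 U) (hS2 : ContDiffOn ℝ (⊤ : ℕ∞) S2 U)
    (hτ1 : ContDiffOn ℝ (⊤ : ℕ∞) τ1 U) (hτ2 : ContDiffOn ℝ (⊤ : ℕ∞) τ2 U)
    (hdecξ1 : ∀ u ∈ U, ∀ i : Fin 2,
      pder ξ1 i u = -fderiv ℝ x u (Matrix.of (S1 u) *ᵥ Pi.single i 1)
        + (τ1 u ⬝ᵥ Pi.single i 1) • ξ1 u)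
    (hdecξ2 : ∀ u ∈ U, ∀ i : Fin 2,
      pder ξ2 i u = -fderiv ℝ x u (Matrix.of (S2 u) *ᵥ Pi.single i 1)
        + (τ2 u ⬝ᵥ Pi.single i 1) • ξ1 u)
    (p : Fin 4 → ℝ)
    (Z : (Fin 2 → ℝ) → (Fin 2 → ℝ)) (δp s : (Fin 2 → ℝ) → ℝ)
    (hZ : ContDiffOn ℝ (⊤ : ℕ∞) Z U) (hδp : ContDiffOn ℝ (⊤ : ℕ∞) δp U)
    (hs : ContDiffOn ℝ (⊤ : ℕ∞) s U)
    (hdist : ∀ u ∈ U, x u - p = fderiv ℝ x u (Z u) + δp u • ξ1 u + s u • ξ2 u)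
    (u0 : Fin 2 → ℝ) (hu0 : u0 ∈ U)
    (hZ0 : Z u0 = 0) :
    (∀ i : Fin 2, fderiv ℝ s u0 (Pi.single i 1) = 0) ∧
    (∀ i j : Fin 2,
      pder (pder s j) i u0 =
        -(Pi.single i 1 ⬝ᵥ (Matrix.of (h2 u0) *ᵥ
          ((1 + δp u0 • Matrix.of (S1 u0) + s u0 • Matrix.of (S2 u0)) *ᵥ
            Pi.single j 1)))) := by
  have diff {F : Type} [NormedAddCommGroup F] [NormedSpace ℝ F] {f : (Fin 2 → ℝ) → F}
      (hf : ContDiffOn ℝ (⊤ : ℕ∞) f U) {u} (hu : u ∈ U) : DifferentiableAt ℝ f u :=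
    (hf.contDiffAt (hU.mem_nhds hu)).differentiableAt (by simp)
  have hZk (k : Fin 2) : ContDiffOn ℝ (⊤ : ℕ∞) (fun u => Z u k) U := contDiffOn_pi.1 hZ k
  have hh2k (j k : Fin 2) : ContDiffOn ℝ (⊤ : ℕ∞) (fun u => h2 u j k) U :=
    contDiffOn_pi.1 (contDiffOn_pi.1 hh2 j) k
  -- The components of the derivative of the decomposition of `x - p`.
  have hcomp : ∀ u ∈ U, ∀ i : Fin 2,
      (fun k => pder (fun w => Z w k) i u) + Z u 0 • Γ u i 0 + Z u 1 • Γ u i 1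
        - δp u • (Matrix.of (S1 u) *ᵥ Pi.single i 1) - s u • (Matrix.of (S2 u) *ᵥ Pi.single i 1)
        - Pi.single i 1 = 0 ∧
      Z u 0 * h2 u i 0 + Z u 1 * h2 u i 1 + pder s i u = 0 := by
    intro u hu i
    have hd (k : Fin 2) : DifferentiableAt ℝ (fun w => Z w k • pder x k w) u :=
      (diff (hZk k) hu).fun_smul (diff (hx.contDiffOn_pder hU k) hu)
    have hδ := (diff hδp hu).fun_smul (diff hξ1 hu)
    have hs' := (diff hs hu).fun_smul (diff hξ2 hu)
    have e := pder_congr hU (f := fun w => x w - p) (g := fun w => Z w 0 • pder x 0 w +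
      Z w 1 • pder x 1 w + δp w • ξ1 w + s w • ξ2 w)
      (fun w hw => by rw [hdist w hw, fderiv_apply_eq_pder]) hu i
    rw [pder_fun_sub_const, pder_fun_add (((hd 0).fun_add (hd 1)).fun_add hδ) hs',
      pder_fun_add ((hd 0).fun_add (hd 1)) hδ, pder_fun_add (hd 0) (hd 1),
      pder_fun_smul (diff (hZk 0) hu) (diff (hx.contDiffOn_pder hU 0) hu),
      pder_fun_smul (diff (hZk 1) hu) (diff (hx.contDiffOn_pder hU 1) hu),
      pder_fun_smul (diff hδp hu) (diff hξ1 hu), pder_fun_smul (diff hs hu) (diff hξ2 hu),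
      hdec2 u hu, hdec2 u hu, hdecξ1 u hu, hdecξ2 u hu] at e
    refine eq_zero_of_fderiv_apply_add_smul_eq_zero (hind u hu)
      (α := Z u 0 * h1 u i 0 + Z u 1 * h1 u i 1 + δp u * (τ1 u ⬝ᵥ Pi.single i 1) + pder δp i u
        + s u * (τ2 u ⬝ᵥ Pi.single i 1)) ?_
    have hZ' : fderiv ℝ x u (fun k => pder (fun w => Z w k) i u) =
        pder (fun w => Z w 0) i u • pder x 0 u + pder (fun w => Z w 1) i u • pder x 1 u :=
      fderiv_apply_eq_pder _ _ _
    have hi : fderiv ℝ x u (Pi.single i 1) = pder x i u := rfl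
    simp only [map_add, map_sub, map_smul, hZ', hi]
    rw [e]
    module
  have hgrad : ∀ j : Fin 2, ∀ u ∈ U,
      pder s j u = -(Z u 0 • h2 u j 0 + Z u 1 • h2 u j 1) := by
    intro j u hu
    simp only [smul_eq_mul]
    linarith [(hcomp u hu j).2]
  refine ⟨fun i => (hgrad i u0 hu0).trans (by simp [hZ0]), fun i j => ?_⟩
  have hd (k : Fin 2) := (diff (hZk k) hu0).fun_smul (diff (hh2k i k) hu0)
  rw [pder_comm hU hs hu0, pder_congr hU (hgrad i) hu0, pder_fun_neg,
    pder_fun_add (hd 0) (hd 1), pder_fun_smul (diff (hZk 0) hu0) (diff (hh2k i 0) hu0),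
    pder_fun_smul (diff (hZk 1) hu0) (diff (hh2k i 1) hu0)]
  have hdZ : (1 + δp u0 • Matrix.of (S1 u0) + s u0 • Matrix.of (S2 u0)) *ᵥ Pi.single j 1 =
      fun k => pder (fun w => Z w k) j u0 := by
    have h := (hcomp u0 hu0 j).1
    simp only [hZ0, Pi.zero_apply, zero_smul, add_zero] at h
    rw [Matrix.add_mulVec, Matrix.add_mulVec, Matrix.one_mulVec, Matrix.smul_mulVec,
      Matrix.smul_mulVec]
    rw [← sub_eq_zero, ← neg_eq_zero, ← h]
    abel
  rw [hdZ, single_one_dotProduct]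
  simp [hZ0, Matrix.mulVec, dotProduct, Fin.sum_univ_two, mul_comm]
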